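/- arXiv:math/9809118 — 2 statements merged into one kernel-verified Lean document; each statement's English description precedes it below -/
import Mathlib

section
/- Let T be a ℤ-weighted lattice tile with weights w : ℤ×ℤ → ℤ. Then T ℤ-shapetiles a square if and only if both: (1) the weighted area ∑ w_{ij} of T is not zero; and (2) for every nonzero rational μ, the greatest common divisor of the weighted areas of the μ-slope classes of T is 1 (equivalently, for every pair of coprime nonzero integers c,d, the gcd over all cosets C of ℤ·(d,−c) in ℤ×ℤ of the sums ∑_{(i,j)∈C} w_{ij} equals 1). -/
open Finset

/-- The ℤ-weighted lattice tile with (finitely supported) weights `w`. -/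
noncomputable def latticeTile (w : ℤ × ℤ →₀ ℤ) (p : ℝ × ℝ) : ℤ :=
  w (⌊p.1⌋, ⌊p.2⌋)

/-- Indicator (with value 1) of the square `[0,s) × [0,s)`, ℤ-valued. -/
noncomputable def sqIndZ (s : ℝ) (p : ℝ × ℝ) : ℤ :=
  if 0 ≤ p.1 ∧ p.1 < s ∧ 0 ≤ p.2 ∧ p.2 < s then 1 else 0

/-- `T` ℤ-shapetiles a square. -/
noncomputable def ZShapeTilesSquare (T : ℝ × ℝ → ℤ) : Prop :=
  ∃ (s : ℝ), 0 < s ∧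
    ∃ (n : ℕ) (a : Fin n → ℤ) (ρ : Fin n → ℝ) (v : Fin n → ℝ × ℝ),
      (∀ i, 0 < ρ i) ∧
      ∀ p : ℝ × ℝ, sqIndZ s p =
        ∑ i, a i * T ((p.1 - (v i).1) / ρ i, (p.2 - (v i).2) / ρ i)


/-- Vanishing of enough power sums forces the weights to cancel on every fibre of `z`. -/
lemma sum_fiber_eq_zero_of_sum_mul_pow_eq_zero {ι D : Type*} [CommRing D] [IsDomain D]
    [DecidableEq D] (S : Finset ι) (a z : ι → D) (hz : ∀ p ∈ S, z p ≠ 0)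
    (h : ∀ k, 1 ≤ k → k ≤ #S → ∑ p ∈ S, a p * z p ^ k = 0) (v : D) :
    ∑ p ∈ S with z p = v, a p = 0 := by
  by_cases hv : v ∈ S.image z
  swap
  · rw [filter_eq_empty_iff.2, sum_empty]
    rintro p hp rfl
    exact hv (mem_image_of_mem _ hp)
  set q : Polynomial D := ∏ u ∈ (S.image z).erase v, (Polynomial.X - Polynomial.C u) with hq
  have hdeg : q.natDegree < #S := by
    rw [hq, Polynomial.natDegree_prod_of_monic _ _ fun u _ => Polynomial.monic_X_sub_C u]
    simp only [Polynomial.natDegree_X_sub_C, sum_const, smul_eq_mul, mul_one]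
    exact (card_erase_lt_of_mem hv).trans_le card_image_le
  have heval : ∀ t, q.eval t = ∏ u ∈ (S.image z).erase v, (t - u) := by
    intro t; simp [hq, Polynomial.eval_prod]
  have hsum : ∑ p ∈ S, a p * z p * q.eval (z p) = 0 := by
    simp only [Polynomial.eval_eq_sum_range, mul_sum]
    rw [sum_comm]
    refine sum_eq_zero fun i hi => ?_
    have := h (i + 1) (by omega) (by have := mem_range.1 hi; omega)
    calc _ = q.coeff i * ∑ p ∈ S, a p * z p ^ (i + 1) := by
          rw [mul_sum]; exact sum_congr rfl fun p _ => by ring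
      _ = 0 := by rw [this, mul_zero]
  have hsplit : ∑ p ∈ S, a p * z p * q.eval (z p)
      = (∑ p ∈ S with z p = v, a p) * (v * q.eval v) := by
    rw [sum_filter, sum_mul]
    refine sum_congr rfl fun p hp => ?_
    split_ifs with hpv
    · rw [hpv]; ring
    · rw [heval (z p), prod_eq_zero (mem_erase.2 ⟨hpv, mem_image_of_mem z hp⟩) (sub_self _)]
      ring
  rw [hsplit] at hsum
  refine (mul_eq_zero.1 hsum).resolve_right (mul_ne_zero ?_ ?_)
  · obtain ⟨p, hp, rfl⟩ := mem_image.1 hv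
    exact hz p hp
  · rw [heval]
    exact prod_ne_zero_iff.2 fun u hu => sub_ne_zero.2 (ne_of_mem_erase hu).symm

/-- Vanishing of enough power sums forces the weights to cancel on every fibre of a function `l`
that is constant on the fibres of `z`. -/
lemma sum_filter_eq_zero_of_sum_mul_pow_eq_zero {ι D N : Type*} [CommRing D] [IsDomain D]
    [DecidableEq N] (S : Finset ι) (a z : ι → D) (hz : ∀ p ∈ S, z p ≠ 0)
    (h : ∀ k, 1 ≤ k → k ≤ #S → ∑ p ∈ S, a p * z p ^ k = 0) (l : ι → N)
    (hl : ∀ p ∈ S, ∀ p' ∈ S, z p = z p' → l p = l p') (n : N) :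
    ∑ p ∈ S with l p = n, a p = 0 := by
  classical
  rw [← sum_fiberwise_of_maps_to (t := S.image z) (g := z)
    (fun p hp => mem_image_of_mem z (mem_filter.1 hp).1)]
  refine sum_eq_zero fun v hv => ?_
  obtain ⟨p₀, hp₀, rfl⟩ := mem_image.1 hv
  by_cases hn : l p₀ = n
  · rw [← sum_fiber_eq_zero_of_sum_mul_pow_eq_zero S a z hz h (z p₀), filter_filter]
    refine sum_congr (filter_congr fun p hp => ?_) fun _ _ => rfl
    exact ⟨fun hp' => hp'.2, fun hp' => ⟨(hl p hp p₀ hp₀ hp').trans hn, hp'⟩⟩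
  · rw [filter_filter, filter_eq_empty_iff.2, sum_empty]
    rintro p hp ⟨h1, h2⟩
    exact hn ((hl p hp p₀ hp₀ h2).symm.trans h1)

section LaurentEval

variable {R S : Type*} [CommRing R] [CommRing S]

/-- The Laurent polynomial with coefficients `w`, evaluated at a pair of units. -/
def laurentEval (w : ℤ × ℤ →₀ ℤ) (x y : Rˣ) : R :=
  ∑ p ∈ w.support, (w p : R) * ((x ^ p.1 * y ^ p.2 : Rˣ) : R)

/-- The generator attached to the tile with weights `w`. -/
def tileGen (w : ℤ × ℤ →₀ ℤ) (x y : Rˣ) : R :=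
  laurentEval w x y * ((1 - (x : R)) * (1 - (y : R)))

lemma map_laurentEval (f : R →+* S) (w : ℤ × ℤ →₀ ℤ) (x y : Rˣ) :
    f (laurentEval w x y) = laurentEval w (Units.map (f : R →* S) x) (Units.map (f : R →* S) y) := by
  simp only [laurentEval, map_sum, map_mul, map_intCast]
  refine sum_congr rfl fun p _ => ?_
  rw [← map_zpow, ← map_zpow, Units.val_mul, map_mul]
  rfl

lemma map_tileGen (f : R →+* S) (w : ℤ × ℤ →₀ ℤ) (x y : Rˣ) :
    f (tileGen w x y) = tileGen w (Units.map (f : R →* S) x) (Units.map (f : R →* S) y) := by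
  simp [tileGen, map_laurentEval]

lemma laurentEval_pow (w : ℤ × ℤ →₀ ℤ) (x y : Rˣ) (k : ℕ) :
    laurentEval w (x ^ k) (y ^ k)
      = ∑ p ∈ w.support, (w p : R) * ((x ^ p.1 * y ^ p.2 : Rˣ) : R) ^ k := by
  refine sum_congr rfl fun p _ => ?_
  rw [← Units.val_pow_eq_pow_val, mul_pow]
  congr 3
  · rw [← zpow_natCast, ← zpow_natCast, ← zpow_mul, ← zpow_mul, mul_comm]
  · rw [← zpow_natCast, ← zpow_natCast, ← zpow_mul, ← zpow_mul, mul_comm]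

end LaurentEval

lemma zpow_ne_one_of_natAbs_le {G : Type*} [Group G] {x : G} {B : ℕ}
    (hx : ∀ k : ℕ, 1 ≤ k → k ≤ B → x ^ k ≠ 1) {a : ℤ} (ha : a ≠ 0) (haB : a.natAbs ≤ B) :
    x ^ a ≠ 1 := by
  have := hx a.natAbs (by omega) haB
  rwa [Ne, pow_natAbs_eq_one] at this

/-- If `x` and `y` have no small-order powers, then the vanishing of many values of the Laurent
polynomial forces all slope classes of some slope to have weighted area zero. -/
lemma exists_slope_of_laurentEval_eq_zero {D : Type*} [CommRing D] [IsDomain D]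
    (w : ℤ × ℤ →₀ ℤ) (E B : ℕ) (hE : ∀ p ∈ w.support, p.1.natAbs ≤ E ∧ p.2.natAbs ≤ E)
    (hB : 8 * E ^ 2 + 2 * E + #w.support ≤ B) (x y : Dˣ)
    (hx : ∀ k : ℕ, 1 ≤ k → k ≤ B → x ^ k ≠ 1) (hy : ∀ k : ℕ, 1 ≤ k → k ≤ B → y ^ k ≠ 1)
    (h : ∀ k : ℕ, 1 ≤ k → k ≤ B → laurentEval w (x ^ k) (y ^ k) = 0) :
    ∃ c d : ℤ, c ≠ 0 ∧ d ≠ 0 ∧ IsCoprime c d ∧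
      ∀ n : ℤ, ((∑ p ∈ w.support with c * p.1 + d * p.2 = n, w p : ℤ) : D) = 0 := by
  set z : ℤ × ℤ → Dˣ := fun p => x ^ p.1 * y ^ p.2 with hz
  suffices H : ∃ c d : ℤ, c ≠ 0 ∧ d ≠ 0 ∧ IsCoprime c d ∧
      ∀ p ∈ w.support, ∀ p' ∈ w.support, z p = z p' →
        c * p.1 + d * p.2 = c * p'.1 + d * p'.2 by
    obtain ⟨c, d, hc, hd, hcd, hl⟩ := H
    refine ⟨c, d, hc, hd, hcd, fun n => ?_⟩
    rw [Int.cast_sum]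
    refine sum_filter_eq_zero_of_sum_mul_pow_eq_zero w.support (fun p => (w p : D))
      (fun p => (z p : D)) (fun p _ => (z p).ne_zero) ?_ (fun p => c * p.1 + d * p.2)
      (fun p hp p' hp' hpp' => hl p hp p' hp' (Units.ext hpp')) n
    intro k hk hk'
    have := h k hk (by omega)
    rwa [laurentEval_pow] at this
  have hrel : ∀ p p', z p = z p' → x ^ (p'.1 - p.1) * y ^ (p'.2 - p.2) = 1 := by
    intro p p' hpp
    simp only [hz] at hpp
    rw [zpow_sub, zpow_sub, mul_mul_mul_comm, ← hpp, ← mul_inv]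
    exact mul_inv_cancel _
  by_cases hex : ∃ p ∈ w.support, ∃ p' ∈ w.support, p ≠ p' ∧ z p = z p'
  swap
  · refine ⟨1, 1, one_ne_zero, one_ne_zero, isCoprime_one_left, fun p hp p' hp' hpp => ?_⟩
    by_contra hne
    exact hex ⟨p, hp, p', hp', fun h => hne (by rw [h]), hpp⟩
  obtain ⟨p, hp, p', hp', hne, hpp⟩ := hex
  have hab := hrel p p' hpp
  have hp1 := hE p hp
  have hp2 := hE p' hp'
  set a := p'.1 - p.1 with ha
  set b := p'.2 - p.2 with hb
  have haE : a.natAbs ≤ 2 * E := by omega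
  have hbE : b.natAbs ≤ 2 * E := by omega
  have hab0 : ¬ (a = 0 ∧ b = 0) := fun hh => hne (Prod.ext (by omega) (by omega))
  have ha0 : a ≠ 0 := by
    intro h0
    have hb0 : b ≠ 0 := fun hb0 => hab0 ⟨h0, hb0⟩
    rw [h0, zpow_zero, one_mul] at hab
    exact zpow_ne_one_of_natAbs_le hy hb0 (by omega) hab
  have hb0 : b ≠ 0 := by
    intro h0
    rw [h0, zpow_zero, mul_one] at hab
    exact zpow_ne_one_of_natAbs_le hx ha0 (by omega) hab
  obtain ⟨g, a₁, b₁, hg, hcop, hag, hbg⟩ : ∃ g a₁ b₁ : ℤ, g ≠ 0 ∧ IsCoprime a₁ b₁ ∧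
      a = a₁ * g ∧ b = b₁ * g := by
    obtain ⟨a₁, ha₁⟩ := Int.gcd_dvd_left a b
    obtain ⟨b₁, hb₁⟩ := Int.gcd_dvd_right a b
    have hg : ((Int.gcd a b : ℕ) : ℤ) ≠ 0 := by
      intro h0; rw [h0, zero_mul] at ha₁; exact ha0 ha₁
    refine ⟨Int.gcd a b, a₁, b₁, hg, ?_, by rw [mul_comm]; exact ha₁, by rw [mul_comm]; exact hb₁⟩
    refine ⟨Int.gcdA a b, Int.gcdB a b, mul_left_cancel₀ hg ?_⟩
    have := Int.gcd_eq_gcd_ab a b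
    linear_combination (-1 : ℤ) * this - (Int.gcdA a b) * ha₁ - (Int.gcdB a b) * hb₁
  refine ⟨-b₁, a₁, ?_, ?_, hcop.symm.neg_left, fun r hr r' hr' hrr => ?_⟩
  · rintro h0; apply hb0; rw [hbg, neg_eq_zero.1 h0, zero_mul]
  · rintro h0; apply ha0; rw [hag, h0, zero_mul]
  have hab' := hrel r r' hrr
  have hr1 := hE r hr
  have hr2 := hE r' hr'
  set a' := r'.1 - r.1 with ha'
  set b' := r'.2 - r.2 with hb'
  have haE' : a'.natAbs ≤ 2 * E := by omega
  have hbE' : b'.natAbs ≤ 2 * E := by omega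
  have hdet : a * b' - a' * b = 0 := by
    by_contra hd
    refine zpow_ne_one_of_natAbs_le hx hd ?_ ?_
    · calc (a * b' - a' * b).natAbs ≤ (a * b').natAbs + (a' * b).natAbs := Int.natAbs_sub_le _ _
        _ = a.natAbs * b'.natAbs + a'.natAbs * b.natAbs := by rw [Int.natAbs_mul, Int.natAbs_mul]
        _ ≤ (2 * E) * (2 * E) + (2 * E) * (2 * E) := by gcongr
        _ ≤ B := by nlinarith
    · have e1 : (x ^ a * y ^ b) ^ b' = 1 := by rw [hab, one_zpow]
      have e2 : (x ^ a' * y ^ b') ^ b = 1 := by rw [hab', one_zpow]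
      rw [mul_zpow, ← zpow_mul, ← zpow_mul] at e1 e2
      rw [zpow_sub, mul_inv_eq_one]
      rw [mul_comm b' b] at e2
      exact mul_right_cancel (e1.trans e2.symm)
  have : g * (-b₁ * a' + a₁ * b') = 0 := by
    rw [hag, hbg] at hdet; linear_combination hdet
  have := (mul_eq_zero.1 this).resolve_left hg
  rw [ha', hb'] at this
  linarith

lemma exists_laurentEval_ne_zero {D : Type*} [CommRing D] [IsDomain D]
    (w : ℤ × ℤ →₀ ℤ) (E B : ℕ) (hE : ∀ p ∈ w.support, p.1.natAbs ≤ E ∧ p.2.natAbs ≤ E)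
    (hB : 8 * E ^ 2 + 2 * E + #w.support ≤ B)
    (hw : ∀ c d : ℤ, c ≠ 0 → d ≠ 0 → IsCoprime c d → ∀ m : ℤ,
      (∀ n : ℤ, m ∣ ∑ p ∈ w.support with c * p.1 + d * p.2 = n, w p) → IsUnit m)
    (x y : Dˣ) (hx : ∀ k : ℕ, 1 ≤ k → k ≤ B → x ^ k ≠ 1)
    (hy : ∀ k : ℕ, 1 ≤ k → k ≤ B → y ^ k ≠ 1) :
    ∃ k : ℕ, 1 ≤ k ∧ k ≤ B ∧ laurentEval w (x ^ k) (y ^ k) ≠ 0 := by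
  by_contra! h
  obtain ⟨c, d, hc, hd, hcd, hs⟩ := exists_slope_of_laurentEval_eq_zero w E B hE hB x y hx hy h
  have hu : IsUnit ((ringChar D : ℕ) : ℤ) := hw c d hc hd hcd _ fun n =>
    (CharP.intCast_eq_zero_iff D (ringChar D) _).1 (hs n)
  have h1 : ringChar D = 1 := by simpa using Int.isUnit_iff_natAbs_eq.1 hu
  have := ringChar.Nat.cast_ringChar (R := D)
  rw [h1, Nat.cast_one] at this
  exact one_ne_zero this

section Units

variable {R : Type*} [CommRing R]

lemma one_sub_dvd_one_sub_pow_of_dvd (a : R) {n s : ℕ} (h : n ∣ s) : 1 - a ^ n ∣ 1 - a ^ s := by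
  obtain ⟨t, rfl⟩ := h
  rw [pow_mul]
  simpa using sub_dvd_pow_sub_pow 1 (a ^ n) t

lemma one_sub_ne_zero_of_units_ne_one {x : Rˣ} (h : x ≠ 1) : 1 - (x : R) ≠ 0 := by
  rw [sub_ne_zero]
  exact fun h' => h (Units.ext h'.symm)

lemma one_sub_mul_one_sub_mem_prime (w : ℤ × ℤ →₀ ℤ) (E B s : ℕ)
    (hE : ∀ p ∈ w.support, p.1.natAbs ≤ E ∧ p.2.natAbs ≤ E)
    (hB : 8 * E ^ 2 + 2 * E + #w.support ≤ B)
    (hw : ∀ c d : ℤ, c ≠ 0 → d ≠ 0 → IsCoprime c d → ∀ m : ℤ,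
      (∀ n : ℤ, m ∣ ∑ p ∈ w.support with c * p.1 + d * p.2 = n, w p) → IsUnit m)
    (hs : ∀ k : ℕ, 1 ≤ k → k ≤ B → k ∣ s) (x y : Rˣ) (𝔭 : Ideal R) [𝔭.IsPrime]
    (h𝔭 : ∀ k : ℕ, 1 ≤ k → k ≤ B → tileGen w (x ^ k) (y ^ k) ∈ 𝔭) :
    (1 - (x : R) ^ s) * (1 - (y : R) ^ s) ∈ 𝔭 := by
  set φ := Ideal.Quotient.mk 𝔭 with hφ
  set x' := Units.map (φ : R →* R ⧸ 𝔭) x with hx'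
  set y' := Units.map (φ : R →* R ⧸ 𝔭) y with hy'
  have aux : ∀ u : Rˣ, ∀ k : ℕ, 1 ≤ k → k ≤ B → Units.map (φ : R →* R ⧸ 𝔭) u ^ k = 1 →
      1 - (u : R) ^ s ∈ 𝔭 := by
    intro u k hk hkB huk
    refine 𝔭.mem_of_dvd (one_sub_dvd_one_sub_pow_of_dvd (u : R) (hs k hk hkB)) ?_
    rw [← Ideal.Quotient.eq_zero_iff_mem, map_sub, map_one, map_pow, sub_eq_zero]
    have := congrArg Units.val huk
    simpa using this.symm
  by_cases hx : ∃ k : ℕ, 1 ≤ k ∧ k ≤ B ∧ x' ^ k = 1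
  · obtain ⟨k, hk, hkB, h⟩ := hx
    exact 𝔭.mul_mem_right _ (aux x k hk hkB h)
  by_cases hy : ∃ k : ℕ, 1 ≤ k ∧ k ≤ B ∧ y' ^ k = 1
  · obtain ⟨k, hk, hkB, h⟩ := hy
    exact 𝔭.mul_mem_left _ (aux y k hk hkB h)
  push Not at hx hy
  obtain ⟨k, hk, hkB, h⟩ := exists_laurentEval_ne_zero w E B hE hB hw x' y' hx hy
  have h0 := Ideal.Quotient.eq_zero_iff_mem.2 (h𝔭 k hk hkB)
  rw [map_tileGen, map_pow, map_pow, ← hx', ← hy', tileGen] at h0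
  exact absurd h0 (mul_ne_zero h (mul_ne_zero (one_sub_ne_zero_of_units_ne_one (hx k hk hkB))
    (one_sub_ne_zero_of_units_ne_one (hy k hk hkB))))

lemma laurentEval_one_one (w : ℤ × ℤ →₀ ℤ) :
    laurentEval w (1 : Rˣ) 1 = ((w.sum fun _ a => a : ℤ) : R) := by
  simp [laurentEval, Finsupp.sum]

lemma one_sub_pow_mul_eq (a : R) (j : ℕ) :
    1 - a ^ j = (∑ i ∈ range j, a ^ i) * (1 - a) :=
  (geom_sum_mul_neg a j).symm

lemma tileGen_swap (w : ℤ × ℤ →₀ ℤ) (x y : Rˣ) :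
    tileGen (w.equivMapDomain (Equiv.prodComm ℤ ℤ)) x y = tileGen w y x := by
  simp only [tileGen, laurentEval]
  rw [mul_comm (1 - (x : R))]
  congr 1
  refine sum_nbij' Prod.swap Prod.swap ?_ ?_ ?_ ?_ ?_ <;>
    simp [Finsupp.equivMapDomain_apply, mul_comm]

/-- The local statement at a prime of residue characteristic zero where `x` has finite order. -/
lemma exists_notMem_mul_mem_of_pow_eq_one (w : ℤ × ℤ →₀ ℤ) (B s n : ℕ) (hB : #w.support ≤ B)
    (hw0 : (w.sum fun _ a => a) ≠ 0) (hs0 : 1 ≤ s) (hs : ∀ k : ℕ, 1 ≤ k → k ≤ B * B → k ∣ s)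
    (x y : Rˣ) (J 𝔭 : Ideal R) [𝔭.IsPrime]
    (hJ : ∀ k : ℕ, 1 ≤ k → tileGen w (x ^ k) (y ^ k) ∈ J)
    (hchar : ∀ n : ℕ, n ≠ 0 → (n : R) ∉ 𝔭) (hn : 1 ≤ n) (hnB : n ≤ B)
    (hxn : Units.map (Ideal.Quotient.mk 𝔭 : R →* R ⧸ 𝔭) x ^ n = 1) :
    ∃ h ∉ 𝔭, h * ((1 - (x : R) ^ s) * (1 - (y : R) ^ s)) ∈ J := by
  set φ := Ideal.Quotient.mk 𝔭 with hφ
  set x' := Units.map (φ : R →* R ⧸ 𝔭) x with hx'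
  set y' := Units.map (φ : R →* R ⧸ 𝔭) y with hy'
  have hnat : ∀ n : ℕ, n ≠ 0 → (n : R ⧸ 𝔭) ≠ 0 := by
    intro n hn h0
    apply hchar n hn
    rw [← Ideal.Quotient.eq_zero_iff_mem, map_natCast, h0]
  have hint : ((w.sum fun _ a => a : ℤ) : R ⧸ 𝔭) ≠ 0 := by
    intro h0
    apply hnat (w.sum fun _ a => a).natAbs (by omega)
    have h1 : (((w.sum fun _ a => a).natAbs : ℤ) : R ⧸ 𝔭) = 0 := by
      rcases Int.natAbs_eq (w.sum fun _ a => a) with h | h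
      · rw [← h, h0]
      · rw [← neg_eq_zero, ← Int.cast_neg, ← h, h0]
    simpa using h1
  have hnB2 : n ≤ B * B := by nlinarith
  by_cases hy : ∃ k : ℕ, 1 ≤ k ∧ k ≤ B * B ∧ y' ^ k = 1
  · obtain ⟨k, hk, hkB, hyk⟩ := hy
    refine ⟨laurentEval w (x ^ s) (y ^ s), ?_, ?_⟩
    · have hxs : x' ^ s = 1 := by
        obtain ⟨t, rfl⟩ := hs n hn hnB2
        rw [pow_mul, hxn, one_pow]
      have hys : y' ^ s = 1 := by
        obtain ⟨t, rfl⟩ := hs k hk hkB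
        rw [pow_mul, hyk, one_pow]
      rw [← Ideal.Quotient.eq_zero_iff_mem, map_laurentEval, map_pow, map_pow, ← hx', ← hy',
        hxs, hys, laurentEval_one_one]
      exact hint
    · have := hJ s hs0
      simpa [tileGen] using this
  push Not at hy
  obtain ⟨j, hj, hjB, hjne⟩ : ∃ j : ℕ, 1 ≤ j ∧ j ≤ B ∧
      laurentEval w (x' ^ (n * j)) (y' ^ (n * j)) ≠ 0 := by
    by_contra! hall
    apply hint
    have := sum_filter_eq_zero_of_sum_mul_pow_eq_zero w.support (fun p => (w p : R ⧸ 𝔭))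
      (fun p => (((x' ^ n) ^ p.1 * (y' ^ n) ^ p.2 : (R ⧸ 𝔭)ˣ) : R ⧸ 𝔭))
      (fun p _ => Units.ne_zero _) ?_ (fun _ => ()) (fun _ _ _ _ _ => rfl) ()
    · simpa [Finsupp.sum] using this
    · intro k hk hkS
      have := hall k hk (hkS.trans hB)
      rwa [pow_mul, pow_mul, laurentEval_pow] at this
  refine ⟨(∑ i ∈ range j, ((x : R) ^ n) ^ i) *
    ((1 - (y : R) ^ (n * j)) * laurentEval w (x ^ (n * j)) (y ^ (n * j))), ?_, ?_⟩
  · rw [← Ideal.Quotient.eq_zero_iff_mem]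
    have hxn' : Ideal.Quotient.mk 𝔭 (x : R) ^ n = 1 := by simpa [hx'] using congrArg Units.val hxn
    rw [map_mul, map_mul, map_laurentEval, map_pow (Units.map _), map_pow (Units.map _),
      ← hx', ← hy', map_sum]
    simp only [map_pow, hxn', one_pow, sum_const, card_range, nsmul_eq_mul, mul_one, map_sub,
      map_one]
    refine mul_ne_zero (hnat j (by omega)) (mul_ne_zero ?_ hjne)
    have := one_sub_ne_zero_of_units_ne_one (hy (n * j) (by nlinarith) (by gcongr))
    simpa [hy'] using this
  · obtain ⟨t, ht⟩ := one_sub_dvd_one_sub_pow_of_dvd (x : R) (hs n hn hnB2)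
    have h1 := J.mul_mem_left (t * (1 - (y : R) ^ s)) (hJ (n * j) (by nlinarith))
    have h2 := one_sub_pow_mul_eq ((x : R) ^ n) j
    rw [← pow_mul] at h2
    rw [tileGen, Units.val_pow_eq_pow_val, Units.val_pow_eq_pow_val, h2] at h1
    rw [ht]
    convert h1 using 1
    ring

lemma exists_notMem_mul_mem (w : ℤ × ℤ →₀ ℤ) (E B s : ℕ)
    (hE : ∀ p ∈ w.support, p.1.natAbs ≤ E ∧ p.2.natAbs ≤ E)
    (hB : 8 * E ^ 2 + 2 * E + #w.support ≤ B) (hw0 : (w.sum fun _ a => a) ≠ 0)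
    (hw : ∀ c d : ℤ, c ≠ 0 → d ≠ 0 → IsCoprime c d → ∀ m : ℤ,
      (∀ n : ℤ, m ∣ ∑ p ∈ w.support with c * p.1 + d * p.2 = n, w p) → IsUnit m)
    (hs0 : 1 ≤ s) (hs : ∀ k : ℕ, 1 ≤ k → k ≤ B * B → k ∣ s) (x y : Rˣ) (J 𝔭 : Ideal R)
    [𝔭.IsPrime] (hJ : ∀ k : ℕ, 1 ≤ k → tileGen w (x ^ k) (y ^ k) ∈ J)
    (hchar : ∀ n : ℕ, n ≠ 0 → (n : R) ∉ 𝔭) :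
    ∃ h ∉ 𝔭, h * ((1 - (x : R) ^ s) * (1 - (y : R) ^ s)) ∈ J := by
  by_cases hx : ∃ k : ℕ, 1 ≤ k ∧ k ≤ B ∧
      Units.map (Ideal.Quotient.mk 𝔭 : R →* R ⧸ 𝔭) x ^ k = 1
  · obtain ⟨k, hk, hkB, h⟩ := hx
    exact exists_notMem_mul_mem_of_pow_eq_one w B s k (by omega) hw0 hs0 hs x y J 𝔭 hJ hchar
      hk hkB h
  by_cases hy : ∃ k : ℕ, 1 ≤ k ∧ k ≤ B ∧
      Units.map (Ideal.Quotient.mk 𝔭 : R →* R ⧸ 𝔭) y ^ k = 1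
  · obtain ⟨k, hk, hkB, h⟩ := hy
    have := exists_notMem_mul_mem_of_pow_eq_one (w.equivMapDomain (Equiv.prodComm ℤ ℤ)) B s k
      ((card_map _).trans_le (by omega)) ?_ hs0 hs y x J 𝔭 ?_ hchar hk hkB h
    · simpa only [mul_comm (1 - (y : R) ^ s)] using this
    · rwa [Finsupp.sum_equivMapDomain]
    · intro k hk
      rw [tileGen_swap]
      exact hJ k hk
  push Not at hx hy
  obtain ⟨k, hk, hkB, h⟩ := exists_laurentEval_ne_zero w E B hE hB hw _ _ hx hy
  refine ⟨tileGen w (x ^ k) (y ^ k), ?_, J.mul_mem_right _ (hJ k hk)⟩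
  rw [← Ideal.Quotient.eq_zero_iff_mem, map_tileGen, map_pow, map_pow, tileGen]
  exact mul_ne_zero h (mul_ne_zero (one_sub_ne_zero_of_units_ne_one (hx k hk hkB))
    (one_sub_ne_zero_of_units_ne_one (hy k hk hkB)))

lemma one_sub_pow_mem_span_pair (a : R) (M N : ℕ) :
    1 - a ^ (M * N.factorial) ∈ Ideal.span {(M : R) * (1 - a), (1 - a) ^ N} := by
  have hexp : 1 - a ^ (M * N.factorial) =
      -∑ i ∈ range (M * N.factorial), (a - 1) ^ (i + 1) * ((M * N.factorial).choose (i + 1) : R) := by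
    have h := add_pow (a - 1) 1 (M * N.factorial)
    rw [sub_add_cancel, sum_range_succ'] at h
    rw [h]
    simp
  rw [hexp, Ideal.neg_mem_iff]
  refine Ideal.sum_mem _ fun i _ => ?_
  by_cases hi : N ≤ i + 1
  · refine Ideal.mem_of_dvd _ ?_ (Ideal.subset_span (Set.mem_insert_of_mem _ rfl))
    refine Dvd.dvd.mul_right (dvd_trans ?_ (pow_dvd_pow _ hi)) _
    exact pow_dvd_pow_of_dvd (by rw [← neg_sub]; exact neg_dvd.2 dvd_rfl) N
  · have hM : M ∣ (M * N.factorial).choose (i + 1) := by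
      obtain ⟨t, ht⟩ := Nat.dvd_factorial (Nat.succ_pos i) (by omega : i + 1 ≤ N)
      rcases Nat.eq_zero_or_pos M with rfl | hM0
      · simp
      have hq : M * N.factorial = (M * N.factorial - 1) + 1 :=
        (Nat.succ_pred_eq_of_pos (Nat.mul_pos hM0 (Nat.factorial_pos N))).symm
      have h1 := Nat.add_one_mul_choose_eq (M * N.factorial - 1) i
      rw [← hq, ht] at h1
      refine ⟨t * (M * N.factorial - 1).choose i, Nat.eq_of_mul_eq_mul_right (Nat.succ_pos i) ?_⟩
      rw [ht, ← h1]
      simp only [Nat.succ_eq_add_one]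
      ring
    refine Ideal.mem_of_dvd _ ?_ (Ideal.subset_span (Set.mem_insert _ _))
    obtain ⟨t, ht⟩ := hM
    rw [ht, ← neg_sub a 1, pow_succ]
    exact ⟨-((a - 1) ^ i * t), by push_cast; ring⟩

lemma one_sub_pow_mul_one_sub_pow_mem (a b : R) (J : Ideal R) (M N : ℕ) (hN : 1 ≤ N)
    (hM : (M : R) * ((1 - a) * (1 - b)) ∈ J) (hrad : ((1 - a) * (1 - b)) ^ N ∈ J) :
    (1 - a ^ (M * N.factorial)) * (1 - b ^ (M * N.factorial)) ∈ J := by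
  obtain ⟨u, v, huv⟩ := Ideal.mem_span_pair.1 (one_sub_pow_mem_span_pair a M N)
  obtain ⟨u', v', huv'⟩ := Ideal.mem_span_pair.1 (one_sub_pow_mem_span_pair b M N)
  obtain ⟨n, rfl⟩ : ∃ n, N = n + 1 := ⟨N - 1, by omega⟩
  rw [mul_pow] at hrad
  rw [← huv, ← huv']
  have h1 := J.mul_mem_left
    (M * u * u' + u * v' * (1 - b) ^ n + u' * v * (1 - a) ^ n) hM
  have h2 := J.mul_mem_left (v * v') hrad
  convert J.add_mem h1 h2 using 1
  ring

/-- The algebraic core: an ideal containing all the scaled generators of a tile contains the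
element corresponding to a square. -/
theorem exists_one_sub_pow_mul_one_sub_pow_mem (w : ℤ × ℤ →₀ ℤ)
    (hw0 : (w.sum fun _ a => a) ≠ 0)
    (hw : ∀ c d : ℤ, c ≠ 0 → d ≠ 0 → IsCoprime c d → ∀ m : ℤ,
      (∀ n : ℤ, m ∣ ∑ p ∈ w.support with c * p.1 + d * p.2 = n, w p) → IsUnit m)
    (x y : Rˣ) (J : Ideal R) (hJ : ∀ k : ℕ, 1 ≤ k → tileGen w (x ^ k) (y ^ k) ∈ J) :
    ∃ s : ℕ, 1 ≤ s ∧ (1 - (x : R) ^ s) * (1 - (y : R) ^ s) ∈ J := by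
  set E := w.support.sup fun p => max p.1.natAbs p.2.natAbs with hEdef
  have hE : ∀ p ∈ w.support, p.1.natAbs ≤ E ∧ p.2.natAbs ≤ E := fun p hp =>
    max_le_iff.1 (le_sup (f := fun p : ℤ × ℤ => max p.1.natAbs p.2.natAbs) hp)
  set B := 8 * E ^ 2 + 2 * E + #w.support with hB
  set s := (B * B).factorial with hs
  have hs0 : 1 ≤ s := Nat.factorial_pos _
  have hsB : ∀ k : ℕ, 1 ≤ k → k ≤ B * B → k ∣ s := fun k hk => Nat.dvd_factorial hk
  have hrad : (1 - (x : R) ^ s) * (1 - (y : R) ^ s) ∈ J.radical := by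
    rw [Ideal.radical_eq_sInf, Ideal.mem_sInf]
    rintro 𝔭 ⟨hJ𝔭, h𝔭⟩
    exact one_sub_mul_one_sub_mem_prime w E B s hE le_rfl hw
      (fun k hk hkB => hsB k hk (by nlinarith)) x y 𝔭 fun k hk _ => hJ𝔭 (hJ k hk)
  obtain ⟨N, hN⟩ := hrad
  obtain ⟨M, hM0, hM⟩ : ∃ M : ℕ, M ≠ 0 ∧
      (M : R) * ((1 - (x : R) ^ s) * (1 - (y : R) ^ s)) ∈ J := by
    by_contra! hno
    set C : Ideal R := J.colon {(1 - (x : R) ^ s) * (1 - (y : R) ^ s)} with hC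
    have hCmem : ∀ r, r ∈ C ↔ r * ((1 - (x : R) ^ s) * (1 - (y : R) ^ s)) ∈ J := fun r => by
      rw [hC, Submodule.mem_colon_singleton, smul_eq_mul]
    have hdisj : Disjoint (C : Set R)
        ((Submonoid.map (Nat.castRingHom R) (nonZeroDivisors ℕ) : Submonoid R) : Set R) := by
      rw [Set.disjoint_left]
      rintro _ hr ⟨n, hn, rfl⟩
      exact hno n (nonZeroDivisors.ne_zero hn) ((hCmem _).1 hr)
    obtain ⟨𝔭, h𝔭, hC𝔭, hd⟩ := Ideal.exists_le_prime_disjoint C _ hdisj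
    obtain ⟨h, hh, hhJ⟩ := exists_notMem_mul_mem w E B s hE le_rfl hw0 hw hs0 hsB x y J 𝔭 hJ
      fun n hn hn𝔭 => Set.disjoint_left.1 hd hn𝔭 ⟨n, mem_nonZeroDivisors_of_ne_zero hn, rfl⟩
    exact hh (hC𝔭 ((hCmem h).2 hhJ))
  refine ⟨s * (M * (N + 1).factorial), Nat.mul_pos hs0
    (Nat.mul_pos (Nat.pos_of_ne_zero hM0) (Nat.factorial_pos _)), ?_⟩
  rw [pow_mul (x : R), pow_mul (y : R)]
  refine one_sub_pow_mul_one_sub_pow_mem _ _ J M (N + 1) (by omega) hM ?_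
  rw [pow_succ]
  exact J.mul_mem_right _ hN

end Units

section StepFunctions

open AddMonoidAlgebra

/-- The monomial with exponent `v`, as a unit of the group ring of the plane. -/
noncomputable def planeMonomial (v : ℝ × ℝ) : (AddMonoidAlgebra ℤ (ℝ × ℝ))ˣ :=
  Units.map (AddMonoidAlgebra.of ℤ (ℝ × ℝ)) (toUnits (Multiplicative.ofAdd v))

lemma val_planeMonomial (v : ℝ × ℝ) :
    (planeMonomial v : AddMonoidAlgebra ℤ (ℝ × ℝ)) = single v 1 := rfl

lemma planeMonomial_add (u v : ℝ × ℝ) :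
    planeMonomial (u + v) = planeMonomial u * planeMonomial v := by
  simp [planeMonomial, ofAdd_add]

lemma planeMonomial_zpow (v : ℝ × ℝ) (n : ℤ) : planeMonomial v ^ n = planeMonomial (n • v) := by
  rw [planeMonomial, planeMonomial, ofAdd_zsmul, map_zpow, map_zpow]

lemma planeMonomial_pow (v : ℝ × ℝ) (n : ℕ) : planeMonomial v ^ n = planeMonomial (n • v) := by
  rw [planeMonomial, planeMonomial, ofAdd_nsmul, map_pow, map_pow]

/-- The step function of an element of the group ring: the monomial with exponent `v` is sent to
the indicator of the quadrant with corner `v`. -/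
noncomputable def stepFun : AddMonoidAlgebra ℤ (ℝ × ℝ) →+ (ℝ × ℝ → ℤ) :=
  (Finsupp.liftAddHom fun v : ℝ × ℝ =>
    { toFun := fun (a : ℤ) (p : ℝ × ℝ) => if v ≤ p then a else 0
      map_zero' := by ext; simp
      map_add' := fun a b => by ext p; simp only [Pi.add_apply]; split_ifs <;> simp }).comp
    coeffAddEquiv.toAddMonoidHom

lemma stepFun_single (v : ℝ × ℝ) (a : ℤ) (p : ℝ × ℝ) :
    stepFun (single v a) p = if v ≤ p then a else 0 := by
  exact congrFun (Finsupp.liftAddHom_apply_single _ v a) p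

lemma stepFun_apply (r : AddMonoidAlgebra ℤ (ℝ × ℝ)) (p : ℝ × ℝ) :
    stepFun r p = ∑ v ∈ r.coeff.support, if v ≤ p then r.coeff v else 0 := by
  simp [stepFun, Finsupp.sum]

lemma stepFun_single_mul (v : ℝ × ℝ) (a : ℤ) (r : AddMonoidAlgebra ℤ (ℝ × ℝ)) (p : ℝ × ℝ) :
    stepFun (single v a * r) p = a * stepFun r (p - v) := by
  induction r using AddMonoidAlgebra.induction_linear with
  | zero => simp
  | add f g hf hg => rw [mul_add, map_add, map_add, Pi.add_apply, Pi.add_apply, hf, hg, mul_add]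
  | single u b =>
    rw [single_mul_single, stepFun_single, stepFun_single]
    simp only [le_sub_iff_add_le, add_comm v u, mul_ite, mul_zero]

lemma stepFun_injective : Function.Injective stepFun := by
  rw [injective_iff_map_eq_zero]
  intro r hr
  by_contra hne
  have hsupp : (r.coeff.support).Nonempty := by
    rw [Finsupp.support_nonempty_iff]
    simpa using hne
  obtain ⟨v, hv⟩ := (r.coeff.support).exists_minimal hsupp
  have h := congrFun hr v
  rw [stepFun_apply, sum_eq_single_of_mem v hv.1] at h
  · simp only [le_refl, if_true, Pi.zero_apply] at h
    exact Finsupp.mem_support_iff.1 hv.1 h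
  · intro u hu huv
    rw [if_neg]
    exact fun hle => huv (le_antisymm hle (hv.2 hu hle))

lemma single_mul_box (u v ρ σ : ℝ) (a : ℤ) :
    (single (u, v) a * ((1 - planeMonomial (ρ, 0)) * (1 - planeMonomial (0, σ))) :
      AddMonoidAlgebra ℤ (ℝ × ℝ)) =
      single (u, v) a - single (u + ρ, v) a - single (u, v + σ) a + single (u + ρ, v + σ) a := by
  have : ∀ b c : AddMonoidAlgebra ℤ (ℝ × ℝ),
      single (u, v) a * ((1 - b) * (1 - c)) = single (u, v) a - single (u, v) a * b
        - single (u, v) a * c + single (u, v) a * b * c := fun b c => by ring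
  rw [this]
  simp [val_planeMonomial, single_mul_single]

lemma stepFun_single_mul_box (u v ρ : ℝ) (hρ : 0 < ρ) (a : ℤ) (p : ℝ × ℝ) :
    stepFun (single (u, v) a * ((1 - planeMonomial (ρ, 0)) * (1 - planeMonomial (0, ρ)))) p =
      if (u ≤ p.1 ∧ p.1 < u + ρ) ∧ (v ≤ p.2 ∧ p.2 < v + ρ) then a else 0 := by
  rw [single_mul_box]
  simp only [map_add, map_sub, Pi.add_apply, Pi.sub_apply, stepFun_single, Prod.le_def]
  by_cases h1 : u ≤ p.1 <;> by_cases h2 : v ≤ p.2 <;> by_cases h3 : u + ρ ≤ p.1 <;>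
    by_cases h4 : v + ρ ≤ p.2 <;> simp [h1, h2, h3, h4] <;> linarith

lemma laurentEval_planeMonomial (w : ℤ × ℤ →₀ ℤ) (ρ : ℝ) :
    laurentEval w (planeMonomial (ρ, 0)) (planeMonomial (0, ρ)) =
      ∑ q ∈ w.support, single ((q.1 * ρ, q.2 * ρ) : ℝ × ℝ) (w q) := by
  refine sum_congr rfl fun q _ => ?_
  rw [planeMonomial_zpow, planeMonomial_zpow, ← planeMonomial_add, val_planeMonomial,
    intCast_def, single_mul_single]
  simp

/-- The group ring element of the tile with weights `w`, rescaled by `ρ`. -/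
noncomputable def scaledTileGen (w : ℤ × ℤ →₀ ℤ) (ρ : ℝ) : AddMonoidAlgebra ℤ (ℝ × ℝ) :=
  tileGen w (planeMonomial (ρ, 0)) (planeMonomial (0, ρ))

lemma stepFun_scaledTileGen (w : ℤ × ℤ →₀ ℤ) (ρ : ℝ) (hρ : 0 < ρ) (p : ℝ × ℝ) :
    stepFun (scaledTileGen w ρ) p = latticeTile w (p.1 / ρ, p.2 / ρ) := by
  have hfloor : ∀ (t : ℝ) (n : ℤ), (n * ρ ≤ t ∧ t < n * ρ + ρ) ↔ n = ⌊t / ρ⌋ := by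
    intro t n
    rw [eq_comm, Int.floor_eq_iff, le_div_iff₀ hρ, div_lt_iff₀ hρ, add_mul, one_mul]
  rw [scaledTileGen, tileGen, laurentEval_planeMonomial, sum_mul, map_sum, Finset.sum_apply]
  simp only [stepFun_single_mul_box _ _ _ hρ, hfloor, latticeTile]
  rw [sum_congr rfl fun q _ => if_congr (Prod.ext_iff (x := q)
    (y := (⌊p.1 / ρ⌋, ⌊p.2 / ρ⌋))).symm rfl rfl, sum_ite_eq']
  simp only [Finsupp.mem_support_iff, ite_not, ite_eq_right_iff]
  exact fun h => h.symm

lemma stepFun_single_mul_scaledTileGen (w : ℤ × ℤ →₀ ℤ) (ρ : ℝ) (hρ : 0 < ρ) (a : ℤ)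
    (v p : ℝ × ℝ) :
    stepFun (single v a * scaledTileGen w ρ) p =
      a * latticeTile w ((p.1 - v.1) / ρ, (p.2 - v.2) / ρ) := by
  rw [stepFun_single_mul, stepFun_scaledTileGen w ρ hρ]
  rfl

/-- The group ring element of the square with side `s`. -/
noncomputable def squareGen (s : ℝ) : AddMonoidAlgebra ℤ (ℝ × ℝ) :=
  (1 - planeMonomial (s, 0)) * (1 - planeMonomial (0, s))

lemma squareGen_eq (s : ℝ) :
    squareGen s = single (0, 0) 1 - single (s, 0) 1 - single (0, s) 1 + single (s, s) 1 := by
  have := single_mul_box 0 0 s s 1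
  simp only [zero_add] at this
  rw [← this, squareGen]
  exact (one_mul _).symm

lemma stepFun_squareGen (s : ℝ) (hs : 0 < s) : stepFun (squareGen s) = sqIndZ s := by
  ext p
  have := stepFun_single_mul_box 0 0 s hs 1 p
  rw [show (single ((0, 0) : ℝ × ℝ) (1 : ℤ)) = 1 from rfl, one_mul] at this
  rw [squareGen, this, sqIndZ]
  simp only [zero_add, and_assoc]

/-- Shapetiling a square, expressed in the group ring of the plane. -/
lemma squareGen_eq_sum_iff (w : ℤ × ℤ →₀ ℤ) {s : ℝ} (hs : 0 < s) {n : ℕ} (a : Fin n → ℤ)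
    (ρ : Fin n → ℝ) (v : Fin n → ℝ × ℝ) (hρ : ∀ i, 0 < ρ i) :
    squareGen s = ∑ i, single (v i) (a i) * scaledTileGen w (ρ i) ↔
      ∀ p : ℝ × ℝ, sqIndZ s p =
        ∑ i, a i * latticeTile w ((p.1 - (v i).1) / ρ i, (p.2 - (v i).2) / ρ i) := by
  rw [← stepFun_injective.eq_iff, stepFun_squareGen s hs, map_sum, funext_iff]
  simp only [Finset.sum_apply, stepFun_single_mul_scaledTileGen w _ (hρ _)]

/-- The ideal generated by all rescalings of a tile. -/
noncomputable def tileIdeal (w : ℤ × ℤ →₀ ℤ) : Ideal (AddMonoidAlgebra ℤ (ℝ × ℝ)) :=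
  Ideal.span {r | ∃ ρ : ℝ, 0 < ρ ∧ r = scaledTileGen w ρ}

lemma exists_eq_sum_of_mem_tileIdeal (w : ℤ × ℤ →₀ ℤ) {r : AddMonoidAlgebra ℤ (ℝ × ℝ)}
    (hr : r ∈ tileIdeal w) :
    ∃ (n : ℕ) (a : Fin n → ℤ) (ρ : Fin n → ℝ) (v : Fin n → ℝ × ℝ), (∀ i, 0 < ρ i) ∧
      r = ∑ i, single (v i) (a i) * scaledTileGen w (ρ i) := by
  have hadd : ∀ f g : AddMonoidAlgebra ℤ (ℝ × ℝ),
      (∃ (n : ℕ) (a : Fin n → ℤ) (ρ : Fin n → ℝ) (v : Fin n → ℝ × ℝ), (∀ i, 0 < ρ i) ∧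
        f = ∑ i, single (v i) (a i) * scaledTileGen w (ρ i)) →
      (∃ (n : ℕ) (a : Fin n → ℤ) (ρ : Fin n → ℝ) (v : Fin n → ℝ × ℝ), (∀ i, 0 < ρ i) ∧
        g = ∑ i, single (v i) (a i) * scaledTileGen w (ρ i)) →
      ∃ (n : ℕ) (a : Fin n → ℤ) (ρ : Fin n → ℝ) (v : Fin n → ℝ × ℝ), (∀ i, 0 < ρ i) ∧
        f + g = ∑ i, single (v i) (a i) * scaledTileGen w (ρ i) := by
    rintro _ _ ⟨n, a, ρ, v, hρ, rfl⟩ ⟨n', a', ρ', v', hρ', rfl⟩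
    refine ⟨n + n', Fin.append a a', Fin.append ρ ρ', Fin.append v v', fun i => ?_, ?_⟩
    · refine Fin.addCases (fun i => ?_) (fun i => ?_) i <;> simp [hρ, hρ']
    · simp [Fin.sum_univ_add]
  have hzero : ∃ (n : ℕ) (a : Fin n → ℤ) (ρ : Fin n → ℝ) (v : Fin n → ℝ × ℝ), (∀ i, 0 < ρ i) ∧
      (0 : AddMonoidAlgebra ℤ (ℝ × ℝ)) = ∑ i, single (v i) (a i) * scaledTileGen w (ρ i) :=
    ⟨0, Fin.elim0, Fin.elim0, Fin.elim0, fun i => i.elim0, by simp⟩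
  induction hr using Submodule.span_induction with
  | mem r hr =>
    obtain ⟨ρ, hρ, rfl⟩ := hr
    exact ⟨1, fun _ => 1, fun _ => ρ, fun _ => 0, fun _ => hρ, by simp [← one_def]⟩
  | zero => exact hzero
  | add f g _ _ hf hg => exact hadd f g hf hg
  | smul c r _ hr =>
    rw [smul_eq_mul]
    induction c using AddMonoidAlgebra.induction_linear with
    | zero => rwa [zero_mul]
    | add f g hf hg => rw [add_mul]; exact hadd _ _ hf hg
    | single u b =>
      obtain ⟨n, a, ρ, v, hρ, rfl⟩ := hr
      refine ⟨n, fun i => b * a i, ρ, fun i => u + v i, hρ, ?_⟩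
      rw [mul_sum]
      exact sum_congr rfl fun i _ => by rw [← mul_assoc, single_mul_single]

end StepFunctions

section Necessity

open AddMonoidAlgebra

/-- The additive functional sending the monomial with exponent `(u, v)` to `u * v`; it computes
areas. -/
noncomputable def areaHom : AddMonoidAlgebra ℤ (ℝ × ℝ) →+ ℝ :=
  (Finsupp.liftAddHom fun v : ℝ × ℝ =>
    (AddMonoidHom.mulRight (v.1 * v.2)).comp (Int.castAddHom ℝ)).comp
    coeffAddEquiv.toAddMonoidHom

lemma areaHom_single (v : ℝ × ℝ) (a : ℤ) : areaHom (single v a) = a * (v.1 * v.2) := by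
  simp [areaHom]

lemma areaHom_single_mul_scaledTileGen (w : ℤ × ℤ →₀ ℤ) (v : ℝ × ℝ) (a : ℤ) (ρ : ℝ) :
    areaHom (single v a * scaledTileGen w ρ) = a * ρ ^ 2 * (w.sum fun _ x => x : ℤ) := by
  rw [scaledTileGen, tileGen, laurentEval_planeMonomial, ← mul_assoc, mul_sum, sum_mul, map_sum,
    Finsupp.sum, Int.cast_sum, mul_sum]
  refine sum_congr rfl fun q _ => ?_
  rw [single_mul_single, show v + ((q.1 * ρ, q.2 * ρ) : ℝ × ℝ) =
    (v.1 + q.1 * ρ, v.2 + q.2 * ρ) from rfl, single_mul_box]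
  simp only [map_add, map_sub, areaHom_single]
  push_cast
  ring

lemma areaHom_squareGen (s : ℝ) : areaHom (squareGen s) = s ^ 2 := by
  simp only [squareGen_eq, map_add, map_sub, areaHom_single]
  push_cast
  ring

/-- The projection of the plane along the slope `-c / d`, on group rings modulo `m`. -/
noncomputable def slopeHom (m : ℕ) (c d : ℤ) :
    AddMonoidAlgebra ℤ (ℝ × ℝ) →ₐ[ℤ] AddMonoidAlgebra (ZMod m) ℝ :=
  AddMonoidAlgebra.lift ℤ (AddMonoidAlgebra (ZMod m) ℝ) (ℝ × ℝ)
    ((AddMonoidAlgebra.of (ZMod m) ℝ).comp (AddMonoidHom.toMultiplicative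
      (c • AddMonoidHom.fst ℝ ℝ + d • AddMonoidHom.snd ℝ ℝ)))

lemma slopeHom_single (m : ℕ) (c d : ℤ) (v : ℝ × ℝ) (a : ℤ) :
    slopeHom m c d (single v a) = single (c * v.1 + d * v.2) (a : ZMod m) := by
  simp [slopeHom, AddMonoidAlgebra.lift_single, smul_single]

lemma slopeHom_scaledTileGen (w : ℤ × ℤ →₀ ℤ) (m : ℕ) (c d : ℤ)
    (hm : ∀ n : ℤ, (m : ℤ) ∣ ∑ p ∈ w.support with c * p.1 + d * p.2 = n, w p) (ρ : ℝ) :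
    slopeHom m c d (scaledTileGen w ρ) = 0 := by
  rw [scaledTileGen, tileGen, map_mul, laurentEval_planeMonomial, map_sum]
  convert zero_mul _
  rw [← sum_fiberwise_of_maps_to (t := w.support.image fun q => c * q.1 + d * q.2)
    (g := fun q => c * q.1 + d * q.2) (fun q hq => mem_image_of_mem _ hq)]
  refine sum_eq_zero fun n _ => ?_
  calc _ = ∑ q ∈ w.support with c * q.1 + d * q.2 = n,
        (single (n * ρ) ((w q : ℤ) : ZMod m) : AddMonoidAlgebra (ZMod m) ℝ) := by
        refine sum_congr rfl fun q hq => ?_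
        rw [slopeHom_single, ← (mem_filter.1 hq).2]
        push_cast
        ring_nf
    _ = single (n * ρ) ((∑ q ∈ w.support with c * q.1 + d * q.2 = n, w q : ℤ) : ZMod m) := by
        rw [Int.cast_sum]
        exact (map_sum (singleAddHom (R := ZMod m) (n * ρ)) _ _).symm
    _ = 0 := by rw [(ZMod.intCast_zmod_eq_zero_iff_dvd _ _).2 (hm n), single_zero]

lemma slopeHom_squareGen_ne_zero (m : ℕ) (hm : m ≠ 1) (c d : ℤ) (hc : c ≠ 0) (hd : d ≠ 0)
    (s : ℝ) (hs : s ≠ 0) : slopeHom m c d (squareGen s) ≠ 0 := by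
  have : Nontrivial (ZMod m) := ZMod.nontrivial_iff.2 hm
  have hc' : (c : ℝ) * s ≠ 0 := mul_ne_zero (Int.cast_ne_zero.2 hc) hs
  have hd' : (d : ℝ) * s ≠ 0 := mul_ne_zero (Int.cast_ne_zero.2 hd) hs
  intro h
  rw [squareGen_eq] at h
  simp only [map_add, map_sub, slopeHom_single, mul_zero, add_zero, zero_add, Int.cast_one] at h
  by_cases hcd : (c : ℝ) * s = d * s
  · have h0 := congrArg (fun f => f.coeff 0) h
    have hne : (d : ℝ) * s + d * s ≠ 0 := by
      rw [← two_mul]; exact mul_ne_zero two_ne_zero hd'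
    simp [hcd, coeff_single, hd', hne] at h0
  · have h0 := congrArg (fun f => f.coeff (c * s)) h
    simp [coeff_single, hc'.symm, hd', Ne.symm hcd] at h0

end Necessity

lemma finsum_slope_class_eq (w : ℤ × ℤ →₀ ℤ) {c d : ℤ} (hd : d ≠ 0) (hcd : IsCoprime c d)
    (i j : ℤ) :
    ∑ᶠ r : ℤ, w (i + r * d, j - r * c) =
      ∑ p ∈ w.support with c * p.1 + d * p.2 = c * i + d * j, w p := by
  set e : ℤ → ℤ × ℤ := fun r => (i + r * d, j - r * c) with he
  have hinj : Function.Injective e := by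
    intro r r' h
    have h1 : i + r * d = i + r' * d := congrArg Prod.fst h
    exact mul_right_cancel₀ hd (add_left_cancel h1)
  rw [← finsum_mem_coe_finset, ← finsum_mem_range (f := fun p => w p) hinj]
  refine finsum_mem_inter_support_eq _ _ _ ?_
  ext p
  simp only [Set.mem_inter_iff, Set.mem_range, Function.mem_support, coe_filter,
    Set.mem_ofPred_eq, Finsupp.mem_support_iff]
  constructor
  · rintro ⟨⟨r, rfl⟩, hp⟩
    exact ⟨⟨hp, by simp only [he]; ring⟩, hp⟩
  · rintro ⟨⟨hp, hl⟩, -⟩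
    refine ⟨?_, hp⟩
    have hdvd : d ∣ c * (p.1 - i) := ⟨j - p.2, by linear_combination hl⟩
    obtain ⟨r, hr⟩ := hcd.symm.dvd_of_dvd_mul_left hdvd
    refine ⟨r, Prod.ext ?_ ?_⟩
    · simp only [he]; linear_combination -hr
    · simp only [he]
      refine mul_left_cancel₀ hd ?_
      linear_combination -hl + c * hr

lemma forall_dvd_slope_class_iff (w : ℤ × ℤ →₀ ℤ) {c d : ℤ} (hd : d ≠ 0) (hcd : IsCoprime c d)
    (m : ℤ) :
    (∀ i j : ℤ, m ∣ ∑ᶠ r : ℤ, w (i + r * d, j - r * c)) ↔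
      ∀ n : ℤ, m ∣ ∑ p ∈ w.support with c * p.1 + d * p.2 = n, w p := by
  simp only [finsum_slope_class_eq w hd hcd]
  refine ⟨fun h n => ?_, fun h i j => h _⟩
  obtain ⟨u, v, huv⟩ := hcd
  have := h (u * n) (v * n)
  rwa [show c * (u * n) + d * (v * n) = n by linear_combination n * huv] at this

/-- A ℤ-weighted lattice tile ℤ-shapetiles a square iff its weighted area is
nonzero and, for every nonzero slope `μ = -c/d` (`c, d` coprime nonzero
integers), the gcd of the weighted areas of the `μ`-slope classes of `T` is 1. -/
theorem z_shapetiles_square_iff (w : ℤ × ℤ →₀ ℤ) :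
    ZShapeTilesSquare (latticeTile w) ↔
      ((w.sum fun _ x => x) ≠ 0 ∧
        ∀ c d : ℤ, c ≠ 0 → d ≠ 0 → IsCoprime c d →
          ∀ m : ℤ, (∀ i j : ℤ, m ∣ ∑ᶠ r : ℤ, w (i + r * d, j - r * c)) → IsUnit m) := by
  constructor
  · rintro ⟨s, hs, n, a, ρ, v, hρ, h⟩
    have hsum := (squareGen_eq_sum_iff w hs a ρ v hρ).2 h
    refine ⟨fun h0 => ?_, fun c d hc hd hcd m hm => ?_⟩
    · have := congrArg areaHom hsum
      simp only [map_sum, areaHom_single_mul_scaledTileGen, h0, areaHom_squareGen, Int.cast_zero,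
        mul_zero, sum_const_zero] at this
      exact hs.ne' (pow_eq_zero_iff two_ne_zero |>.1 this)
    · rw [forall_dvd_slope_class_iff w hd hcd] at hm
      rw [Int.isUnit_iff_natAbs_eq]
      by_contra hm1
      refine slopeHom_squareGen_ne_zero m.natAbs hm1 c d hc hd s hs.ne' ?_
      rw [hsum, map_sum]
      refine sum_eq_zero fun i _ => ?_
      rw [map_mul, slopeHom_scaledTileGen w _ c d (fun n => Int.natAbs_dvd.2 (hm n)), mul_zero]
  · rintro ⟨hw0, hw⟩
    have hpow : ∀ k : ℕ, planeMonomial (1, 0) ^ k = planeMonomial (k, 0) ∧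
        planeMonomial (0, 1) ^ k = planeMonomial (0, k) := fun k => by
      simp [planeMonomial_pow]
    obtain ⟨s, hs, hmem⟩ := exists_one_sub_pow_mul_one_sub_pow_mem w hw0
      (fun c d hc hd hcd m hm => hw c d hc hd hcd m
        ((forall_dvd_slope_class_iff w hd hcd m).2 hm))
      (planeMonomial (1, 0)) (planeMonomial (0, 1)) (tileIdeal w) fun k hk => by
        rw [(hpow k).1, (hpow k).2]
        exact Ideal.subset_span ⟨k, by exact_mod_cast hk, rfl⟩
    rw [← Units.val_pow_eq_pow_val, ← Units.val_pow_eq_pow_val, (hpow s).1, (hpow s).2] at hmem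
    obtain ⟨n, a, ρ, v, hρ, h⟩ := exists_eq_sum_of_mem_tileIdeal w hmem
    have hs' : (0 : ℝ) < s := by exact_mod_cast hs
    exact ⟨s, hs', n, a, ρ, v, hρ, (squareGen_eq_sum_iff w hs' a ρ v hρ).1 h⟩
end

section
/- Let T : ℝ² → ℤ be the S-shaped tetromino tile T = 𝟙_{[0,2)×[0,1)} + 𝟙_{[1,3)×[1,2)}. Then T does not ℤ-shapetile a square, although T does ℚ-shapetile a square (regarding T as a ℚ-weighted tile). -/
open Finset

/-- Indicator (with value 1) of the rectangle `[b1,b2) × [c1,c2)`, with values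
in a ring `A`. -/
noncomputable def rectInd (A : Type*) [CommRing A] (b1 b2 c1 c2 : ℝ)
    (p : ℝ × ℝ) : A :=
  if b1 ≤ p.1 ∧ p.1 < b2 ∧ c1 ≤ p.2 ∧ p.2 < c2 then 1 else 0

/-- `T` `A`-shapetiles a square. -/
noncomputable def ShapeTilesSquare (A : Type*) [CommRing A] (T : ℝ × ℝ → A) : Prop :=
  ∃ (s : ℝ), 0 < s ∧
    ∃ (n : ℕ) (a : Fin n → A) (ρ : Fin n → ℝ) (v : Fin n → ℝ × ℝ),
      (∀ i, 0 < ρ i) ∧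
      ∀ p : ℝ × ℝ, rectInd A 0 s 0 s p =
        ∑ i, a i * T ((p.1 - (v i).1) / ρ i, (p.2 - (v i).2) / ρ i)

/-- The indicator of `[b, ∞)`. -/
noncomputable def stepInd (A : Type*) [CommRing A] (b x : ℝ) : A :=
  if b ≤ x then 1 else 0

theorem rectInd_eq_stepInd (A : Type*) [CommRing A] {b1 b2 c1 c2 : ℝ} (hb : b1 ≤ b2)
    (hc : c1 ≤ c2) (p : ℝ × ℝ) :
    rectInd A b1 b2 c1 c2 p =
      (stepInd A b1 p.1 - stepInd A b2 p.1) * (stepInd A c1 p.2 - stepInd A c2 p.2) := by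
  unfold rectInd stepInd
  by_cases h1 : b1 ≤ p.1 <;> by_cases h2 : b2 ≤ p.1 <;> by_cases h3 : c1 ≤ p.2 <;>
    by_cases h4 : c2 ≤ p.2 <;> simp [h1, h2, h3, h4] <;> linarith

theorem intCast_rectInd (A : Type*) [CommRing A] (b1 b2 c1 c2 : ℝ) (p : ℝ × ℝ) :
    ((rectInd ℤ b1 b2 c1 c2 p : ℤ) : A) = rectInd A b1 b2 c1 c2 p := by
  unfold rectInd
  split_ifs <;> simp

theorem rectInd_rescale (A : Type*) [CommRing A] (b1 b2 c1 c2 : ℝ) {ρ : ℝ} (hρ : 0 < ρ)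
    (v p : ℝ × ℝ) :
    rectInd A b1 b2 c1 c2 ((p.1 - v.1) / ρ, (p.2 - v.2) / ρ) =
      rectInd A (v.1 + b1 * ρ) (v.1 + b2 * ρ) (v.2 + c1 * ρ) (v.2 + c2 * ρ) p := by
  unfold rectInd
  simp only [le_div_iff₀ hρ, div_lt_iff₀ hρ, le_sub_iff_add_le', sub_lt_iff_lt_add']

/-- The length of the part of the line `x - y = t` (parametrized by `y`) inside the rectangle
`[b1,b2) × [c1,c2)`, as a combination of ramps at the corners. -/
noncomputable def diagLength (b1 b2 c1 c2 t : ℝ) : ℝ :=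
  max 0 (b2 - c1 - t) - max 0 (b1 - c1 - t) - max 0 (b2 - c2 - t) + max 0 (b1 - c2 - t)

theorem rectInd_diag (b1 b2 c1 c2 t : ℝ) :
    (fun y : ℝ => rectInd ℝ b1 b2 c1 c2 (y + t, y)) =
      (Set.Ico (max (b1 - t) c1) (min (b2 - t) c2)).indicator 1 := by
  funext y
  simp only [rectInd, Set.indicator_apply, Set.mem_Ico, max_le_iff, lt_min_iff,
    sub_le_iff_le_add, lt_sub_iff_add_lt, Pi.one_apply]
  congr 1
  apply propext
  tauto

theorem integrable_rectInd_diag (b1 b2 c1 c2 t : ℝ) :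
    MeasureTheory.Integrable (fun y : ℝ => rectInd ℝ b1 b2 c1 c2 (y + t, y)) := by
  rw [rectInd_diag]
  exact (MeasureTheory.integrable_indicator_iff measurableSet_Ico).2
    (MeasureTheory.integrableOn_const measure_Ico_lt_top.ne)

theorem integral_rectInd_diag {b1 b2 c1 c2 : ℝ} (hb : b1 ≤ b2) (hc : c1 ≤ c2) (t : ℝ) :
    ∫ y : ℝ, rectInd ℝ b1 b2 c1 c2 (y + t, y) = diagLength b1 b2 c1 c2 t := by
  rw [rectInd_diag, MeasureTheory.integral_indicator_one measurableSet_Ico,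
    Real.volume_real_Ico, diagLength]
  grind

theorem exists_hasDerivAt_ramp {c t : ℝ} (h : t ≠ c) :
    ∃ m : ℤ, HasDerivAt (fun t => max 0 (c - t)) (m : ℝ) t := by
  rcases lt_or_gt_of_ne h with h | h
  · refine ⟨-1, HasDerivAt.congr_of_eventuallyEq (f := fun t => c - t) ?_ ?_⟩
    · simpa using (hasDerivAt_id t).const_sub c
    · filter_upwards [eventually_lt_nhds h] with u hu
      exact max_eq_right (by linarith)
  · refine ⟨0, HasDerivAt.congr_of_eventuallyEq (f := fun _ => 0) ?_ ?_⟩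
    · simpa using hasDerivAt_const t (0 : ℝ)
    · filter_upwards [eventually_gt_nhds h] with u hu
      exact max_eq_left (by linarith)

theorem exists_hasDerivAt_diagLength {b1 b2 c1 c2 t : ℝ}
    (h : t ∉ ({b2 - c1, b1 - c1, b2 - c2, b1 - c2} : Set ℝ)) :
    ∃ m : ℤ, HasDerivAt (diagLength b1 b2 c1 c2) (m : ℝ) t := by
  simp only [Set.mem_insert_iff, Set.mem_singleton_iff, not_or] at h
  obtain ⟨m1, h1⟩ := exists_hasDerivAt_ramp h.1
  obtain ⟨m2, h2⟩ := exists_hasDerivAt_ramp h.2.1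
  obtain ⟨m3, h3⟩ := exists_hasDerivAt_ramp h.2.2.1
  obtain ⟨m4, h4⟩ := exists_hasDerivAt_ramp h.2.2.2
  refine ⟨m1 - m2 - m3 + m4, ?_⟩
  push_cast
  exact ((h1.sub h2).sub h3).add h4

theorem hasDerivAt_diagLength_square {s t : ℝ} (h0 : 0 < t) (hs : t < s) :
    HasDerivAt (diagLength 0 s 0 s) (-1) t := by
  refine HasDerivAt.congr_of_eventuallyEq (f := fun t => s - t) ?_ ?_
  · simpa using (hasDerivAt_id t).const_sub s
  · filter_upwards [eventually_gt_nhds h0, eventually_lt_nhds hs] with u hu hu'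
    simp only [diagLength]
    rw [max_eq_right (by linarith), max_eq_left (by linarith), max_eq_left (by linarith),
      max_eq_left (by linarith)]
    ring

theorem diagLength_add (b1 b2 c1 c2 r t : ℝ) :
    diagLength (b1 + r) (b2 + r) (c1 + r) (c2 + r) t = diagLength b1 b2 c1 c2 t := by
  simp only [diagLength, add_sub_add_right_eq_sub]

theorem s_tetromino_rescale (A : Type*) [CommRing A] {T : ℝ × ℝ → ℤ}
    (hT : ∀ p, T p = rectInd ℤ 0 2 0 1 p + rectInd ℤ 1 3 1 2 p) {ρ : ℝ} (hρ : 0 < ρ)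
    (v p : ℝ × ℝ) :
    (T ((p.1 - v.1) / ρ, (p.2 - v.2) / ρ) : A) =
      rectInd A v.1 (v.1 + 2 * ρ) v.2 (v.2 + ρ) p +
      rectInd A (v.1 + ρ) (v.1 + 2 * ρ + ρ) (v.2 + ρ) (v.2 + ρ + ρ) p := by
  rw [hT, Int.cast_add, intCast_rectInd, intCast_rectInd, rectInd_rescale A _ _ _ _ hρ,
    rectInd_rescale A _ _ _ _ hρ]
  ring_nf

theorem not_shapeTilesSquare_int {T : ℝ × ℝ → ℤ}
    (hT : ∀ p, T p = rectInd ℤ 0 2 0 1 p + rectInd ℤ 1 3 1 2 p) :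
    ¬ ShapeTilesSquare ℤ T := by
  rintro ⟨s, hs, n, a, ρ, v, hρ, h⟩
  let H (i : Fin n) : ℝ → ℝ :=
    diagLength (v i).1 ((v i).1 + 2 * ρ i) (v i).2 ((v i).2 + ρ i)
  have key (t : ℝ) : diagLength 0 s 0 s t = 2 * ∑ i, (a i : ℝ) * H i t := by
    rw [← integral_rectInd_diag hs.le hs.le]
    have e (y : ℝ) : rectInd ℝ 0 s 0 s (y + t, y) = ∑ i, (a i : ℝ) *
        (rectInd ℝ (v i).1 ((v i).1 + 2 * ρ i) (v i).2 ((v i).2 + ρ i) (y + t, y) +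
         rectInd ℝ ((v i).1 + ρ i) ((v i).1 + 2 * ρ i + ρ i) ((v i).2 + ρ i)
          ((v i).2 + ρ i + ρ i) (y + t, y)) := by
      rw [← intCast_rectInd, h, Int.cast_sum]
      refine sum_congr rfl fun i _ => ?_
      rw [Int.cast_mul, s_tetromino_rescale ℝ hT (hρ i)]
    simp only [e]
    rw [MeasureTheory.integral_finsetSum, mul_sum]
    swap
    · exact fun i _ =>
        ((integrable_rectInd_diag ..).add (integrable_rectInd_diag ..)).const_mul _
    refine sum_congr rfl fun i _ => ?_
    have := hρ i
    rw [MeasureTheory.integral_const_mul, MeasureTheory.integral_add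
      (integrable_rectInd_diag ..) (integrable_rectInd_diag ..),
      integral_rectInd_diag (by linarith) (by linarith),
      integral_rectInd_diag (by linarith) (by linarith), diagLength_add]
    ring
  have hfin : (⋃ i, ({(v i).1 + 2 * ρ i - (v i).2, (v i).1 - (v i).2,
      (v i).1 + 2 * ρ i - ((v i).2 + ρ i), (v i).1 - ((v i).2 + ρ i)} : Set ℝ)).Finite :=
    Set.finite_iUnion fun i => Set.toFinite _
  obtain ⟨t, ⟨h0, hts⟩, ht⟩ := (Set.Ioo_infinite hs).exists_notMem_finite hfin
  rw [Set.mem_iUnion, not_exists] at ht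
  choose m hm using fun i => exists_hasDerivAt_diagLength (ht i)
  have hsum : HasDerivAt (fun t => 2 * ∑ i, (a i : ℝ) * H i t)
      (2 * ∑ i, (a i : ℝ) * (m i : ℝ)) t :=
    (HasDerivAt.fun_sum fun i _ => (hm i).const_mul _).const_mul _
  have heq := (hasDerivAt_diagLength_square h0 hts).unique (funext key ▸ hsum)
  have hint : (-1 : ℤ) = 2 * ∑ i, a i * m i := by exact_mod_cast heq
  omega

theorem shapeTilesSquare_rat {T : ℝ × ℝ → ℤ}
    (hT : ∀ p, T p = rectInd ℤ 0 2 0 1 p + rectInd ℤ 1 3 1 2 p) :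
    ShapeTilesSquare ℚ (fun p => (T p : ℚ)) := by
  have hρ : ∀ i, 0 < (![2, 2, 1, 1, 1, 1, 1, 1, 1, 1, 1, 1, 1, 1, 1, 1, 1, 1] :
      Fin 18 → ℝ) i := by
    intro i
    fin_cases i <;> norm_num
  refine ⟨4, by norm_num, 18,
    ![1/2, 1/2, 1/2, 1/2, 1/2, 1/2, 1/2, 1/2, 1/2, 1/2,
      -1/2, -1/2, -1/2, -1/2, -1/2, -1/2, -1/2, -1/2], _,
    ![(0, 0), (0, 2), (0, 0), (0, 1), (0, 2), (0, 3), (2, 0), (2, 1), (2, 2), (2, 3),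
      (1, 1), (1, 2), (1, 3), (1, 4), (3, 1), (3, 2), (3, 3), (3, 4)], hρ, fun p => ?_⟩
  have e (ρ : ℝ) (hρ : 0 < ρ) (v : ℝ × ℝ) :
      (T ((p.1 - v.1) / ρ, (p.2 - v.2) / ρ) : ℚ) =
        (stepInd ℚ v.1 p.1 - stepInd ℚ (v.1 + 2 * ρ) p.1) *
          (stepInd ℚ v.2 p.2 - stepInd ℚ (v.2 + ρ) p.2) +
        (stepInd ℚ (v.1 + ρ) p.1 - stepInd ℚ (v.1 + 2 * ρ + ρ) p.1) *
          (stepInd ℚ (v.2 + ρ) p.2 - stepInd ℚ (v.2 + ρ + ρ) p.2) := by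
    rw [s_tetromino_rescale ℚ hT hρ, rectInd_eq_stepInd ℚ (by linarith) (by linarith),
      rectInd_eq_stepInd ℚ (by linarith) (by linarith)]
  rw [rectInd_eq_stepInd ℚ (by norm_num) (by norm_num),
    sum_congr rfl fun i _ => congrArg _ (e _ (hρ i) _)]
  simp only [Fin.sum_univ_succ, Fin.sum_univ_zero, Matrix.cons_val_zero, Matrix.cons_val_succ]
  norm_num
  ring

/-- The S-shaped tetromino `𝟙_{[0,2)×[0,1)} + 𝟙_{[1,3)×[1,2)}` does not
ℤ-shapetile a square, but it does ℚ-shapetile a square. -/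
theorem s_tetromino_shapetiling (T : ℝ × ℝ → ℤ)
    (hT : ∀ p, T p = rectInd ℤ 0 2 0 1 p + rectInd ℤ 1 3 1 2 p) :
    ¬ ShapeTilesSquare ℤ T ∧ ShapeTilesSquare ℚ (fun p => (T p : ℚ)) :=
  ⟨not_shapeTilesSquare_int hT, shapeTilesSquare_rat hT⟩
end
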